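/- arXiv:2411.19499 — 3 statements merged into one kernel-verified Lean document; each statement's English description precedes it below -/
import Mathlib

section
/- Let X : ℝ² → ℝ³ be the timelike Enneper surface X(u,v) = ( e^{2u}·cosh(2v) , e^u(3·cosh v − e^{2u}·cosh(3v))/3 , e^u(3·sinh v + e^{2u}·sinh(3v))/3 ). Then for all (u,v) ∈ ℝ²: ⟨X_u, X_u⟩ = e^{2u}(1 + e^{2u})², ⟨X_v, X_v⟩ = −e^{2u}(1 + e^{2u})², ⟨X_u, X_v⟩ = 0, and X_{uu} − X_{vv} = 0. In particular, X is a paraconformally parametrized timelike surface with first fundamental form e^{2u}(1+e^{2u})²(du² − dv²) and zero mean curvature. -/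
noncomputable section

open Real

/-- The Lorentzian inner product on `ℝ³ = ℝ × ℝ × ℝ`:
`⟨x, y⟩ = x₁y₁ + x₂y₂ − x₃y₃`. -/
def lint (x y : ℝ × ℝ × ℝ) : ℝ := x.1 * y.1 + x.2.1 * y.2.1 - x.2.2 * y.2.2

/-- Partial derivative with respect to the first variable. -/
def pu (X : ℝ → ℝ → ℝ × ℝ × ℝ) (u v : ℝ) : ℝ × ℝ × ℝ := deriv (fun t => X t v) u

/-- Partial derivative with respect to the second variable. -/
def pv (X : ℝ → ℝ → ℝ × ℝ × ℝ) (u v : ℝ) : ℝ × ℝ × ℝ := deriv (fun t => X u t) v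

/-- The timelike Enneper surface. -/
def EnneperT (u v : ℝ) : ℝ × ℝ × ℝ :=
  (Real.exp (2 * u) * Real.cosh (2 * v),
   Real.exp u * (3 * Real.cosh v - Real.exp (2 * u) * Real.cosh (3 * v)) / 3,
   Real.exp u * (3 * Real.sinh v + Real.exp (2 * u) * Real.sinh (3 * v)) / 3)

/-- Elementary rewriting of the exponential and hyperbolic functions at multiples. -/
lemma exp_two_mul_aux (u : ℝ) : Real.exp (2 * u) = Real.exp u ^ 2 := by
  rw [← Real.exp_nat_mul]; norm_num

lemma hasDerivAt_exp_two (u : ℝ) :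
    HasDerivAt (fun t : ℝ => Real.exp (2 * t)) (2 * Real.exp (2 * u)) u := by
  have h := ((hasDerivAt_id u).const_mul 2).exp
  simp only [id] at h
  exact h.congr_deriv (by ring)

lemma hasDerivAt_cosh_mul (k v : ℝ) :
    HasDerivAt (fun t : ℝ => Real.cosh (k * t)) (k * Real.sinh (k * v)) v := by
  have h := ((hasDerivAt_id v).const_mul k).cosh
  simp only [id] at h
  exact h.congr_deriv (by ring)

lemma hasDerivAt_sinh_mul (k v : ℝ) :
    HasDerivAt (fun t : ℝ => Real.sinh (k * t)) (k * Real.cosh (k * v)) v := by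
  have h := ((hasDerivAt_id v).const_mul k).sinh
  simp only [id] at h
  exact h.congr_deriv (by ring)

lemma pu_EnneperT : pu EnneperT = fun u v =>
    (2 * Real.exp (2 * u) * Real.cosh (2 * v),
     Real.exp u * (Real.cosh v - Real.exp (2 * u) * Real.cosh (3 * v)),
     Real.exp u * (Real.sinh v + Real.exp (2 * u) * Real.sinh (3 * v))) := by
  funext u v
  have e2 := hasDerivAt_exp_two u
  have e1 := Real.hasDerivAt_exp u
  refine HasDerivAt.deriv (HasDerivAt.prodMk ?_ (HasDerivAt.prodMk ?_ ?_))
  · exact e2.mul_const _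
  · exact ((e1.mul ((e2.mul_const (Real.cosh (3 * v))).const_sub
      (3 * Real.cosh v))).div_const 3).congr_deriv (by ring)
  · exact ((e1.mul ((e2.mul_const (Real.sinh (3 * v))).const_add
      (3 * Real.sinh v))).div_const 3).congr_deriv (by ring)

lemma pv_EnneperT : pv EnneperT = fun u v =>
    (2 * Real.exp (2 * u) * Real.sinh (2 * v),
     Real.exp u * (Real.sinh v - Real.exp (2 * u) * Real.sinh (3 * v)),
     Real.exp u * (Real.cosh v + Real.exp (2 * u) * Real.cosh (3 * v))) := by
  funext u v
  refine HasDerivAt.deriv (HasDerivAt.prodMk ?_ (HasDerivAt.prodMk ?_ ?_))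
  · exact ((hasDerivAt_cosh_mul 2 v).const_mul (Real.exp (2 * u))).congr_deriv (by ring)
  · exact (((((Real.hasDerivAt_cosh v).const_mul 3).sub ((hasDerivAt_cosh_mul 3 v).const_mul
      (Real.exp (2 * u)))).const_mul (Real.exp u)).div_const 3).congr_deriv (by ring)
  · exact (((((Real.hasDerivAt_sinh v).const_mul 3).add ((hasDerivAt_sinh_mul 3 v).const_mul
      (Real.exp (2 * u)))).const_mul (Real.exp u)).div_const 3).congr_deriv (by ring)

lemma pu_pu_EnneperT (u v : ℝ) : pu (pu EnneperT) u v =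
    (4 * Real.exp (2 * u) * Real.cosh (2 * v),
     Real.exp u * (Real.cosh v - 3 * Real.exp (2 * u) * Real.cosh (3 * v)),
     Real.exp u * (Real.sinh v + 3 * Real.exp (2 * u) * Real.sinh (3 * v))) := by
  rw [pu_EnneperT]
  have e2 := hasDerivAt_exp_two u
  have e1 := Real.hasDerivAt_exp u
  refine HasDerivAt.deriv (HasDerivAt.prodMk ?_ (HasDerivAt.prodMk ?_ ?_))
  · exact ((e2.const_mul 2).mul_const _).congr_deriv (by ring)
  · exact (e1.mul ((e2.mul_const (Real.cosh (3 * v))).const_sub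
      (Real.cosh v))).congr_deriv (by ring)
  · exact (e1.mul ((e2.mul_const (Real.sinh (3 * v))).const_add
      (Real.sinh v))).congr_deriv (by ring)

lemma pv_pv_EnneperT (u v : ℝ) : pv (pv EnneperT) u v =
    (4 * Real.exp (2 * u) * Real.cosh (2 * v),
     Real.exp u * (Real.cosh v - 3 * Real.exp (2 * u) * Real.cosh (3 * v)),
     Real.exp u * (Real.sinh v + 3 * Real.exp (2 * u) * Real.sinh (3 * v))) := by
  rw [pv_EnneperT]
  refine HasDerivAt.deriv (HasDerivAt.prodMk ?_ (HasDerivAt.prodMk ?_ ?_))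
  · exact ((hasDerivAt_sinh_mul 2 v).const_mul (2 * Real.exp (2 * u))).congr_deriv (by ring)
  · exact (((Real.hasDerivAt_sinh v).sub ((hasDerivAt_sinh_mul 3 v).const_mul
      (Real.exp (2 * u)))).const_mul (Real.exp u)).congr_deriv (by ring)
  · exact (((Real.hasDerivAt_cosh v).add ((hasDerivAt_cosh_mul 3 v).const_mul
      (Real.exp (2 * u)))).const_mul (Real.exp u)).congr_deriv (by ring)

/-- The timelike Enneper surface is a paraconformal wave-harmonic (hence zero mean
curvature timelike) parametrization with first fundamental form
`e^{2u}(1+e^{2u})²(du² − dv²)`. -/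
theorem stmt2 (u v : ℝ) :
    lint (pu EnneperT u v) (pu EnneperT u v)
        = Real.exp (2 * u) * (1 + Real.exp (2 * u)) ^ 2 ∧
    lint (pv EnneperT u v) (pv EnneperT u v)
        = -(Real.exp (2 * u) * (1 + Real.exp (2 * u)) ^ 2) ∧
    lint (pu EnneperT u v) (pv EnneperT u v) = 0 ∧
    pu (pu EnneperT) u v - pv (pv EnneperT) u v = 0 := by
  have hC : Real.cosh v ^ 2 = Real.sinh v ^ 2 + 1 := Real.cosh_sq v
  refine ⟨?_, ?_, ?_, ?_⟩
  · simp only [pu_EnneperT, lint, Real.cosh_two_mul, Real.cosh_three_mul, Real.sinh_three_mul,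
      exp_two_mul_aux]
    generalize Real.cosh v = c at *
    generalize Real.sinh v = s at *
    grind
  · simp only [pv_EnneperT, lint, Real.sinh_two_mul, Real.cosh_three_mul, Real.sinh_three_mul,
      exp_two_mul_aux]
    generalize Real.cosh v = c at *
    generalize Real.sinh v = s at *
    grind
  · simp only [pu_EnneperT, pv_EnneperT, lint, Real.cosh_two_mul, Real.sinh_two_mul,
      Real.cosh_three_mul, Real.sinh_three_mul, exp_two_mul_aux]
    generalize Real.cosh v = c at *
    generalize Real.sinh v = s at *
    grind
  · rw [pu_pu_EnneperT, pv_pv_EnneperT, sub_self]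
end
end

section
/- (Analytic core of the main theorem, timelike case.) Let I, J ⊆ ℝ be nonempty open intervals. Let ρ, λ₁, λ₂ : I → ℝ and α : J → ℝ be differentiable, with ρ(u) > 0 and λ₁(u) ≠ λ₂(u) for every u ∈ I, and suppose there exists v₀ ∈ J with sinh(2α(v₀)) ≠ 0. Assume the Codazzi equations hold: for all u ∈ I and v ∈ J, (i) sinh(2α(v))·ρ(u)·(λ₁'(u) + λ₂'(u)) = 0 and (ii) sinh²(α(v))·λ₁'(u) + cosh²(α(v))·λ₂'(u) + (1/ρ(u))·(λ₁(u) − λ₂(u))·(ρ(u)·α'(v) − ρ'(u)) = 0. Then λ₁ + λ₂ is constant on I (so the mean curvature is constant) and there exist constants a, c ∈ ℝ with α(v) = a·v + c for all v ∈ J. -/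
noncomputable section

open Real

theorem const_aux (I : Set ℝ) (hc : I.OrdConnected) (f : ℝ → ℝ)
    (hf : ∀ u ∈ I, HasDerivAt f 0 u) : ∀ x ∈ I, ∀ y ∈ I, f x = f y := by
  intro x hx y hy
  have h := hc.convex.norm_image_sub_le_of_norm_hasDerivWithin_le (f := f) (f' := fun _ => 0)
    (C := 0) (fun u hu => (hf u hu).hasDerivWithinAt) (by simp) hy hx
  have h' : ‖f x - f y‖ ≤ 0 := by simpa using h
  exact sub_eq_zero.mp (norm_le_zero_iff.mp h')

/-- Analytic core of the main theorem, timelike case.  If the Codazzi equations of a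
timelike intrinsic rotational surface with twist `α` hold, there are no umbilic
points (`λ₁ ≠ λ₂`), and the twist is not identically zero
(`sinh(2α(v₀)) ≠ 0` for some `v₀ ∈ J`), then the mean curvature is constant
(`λ₁ + λ₂` is constant) and the twist is linear, `α(v) = a·v + c`. -/
theorem stmt7 (I J : Set ℝ)
    (hIne : I.Nonempty) (hIopen : IsOpen I) (hIconn : I.OrdConnected)
    (hJne : J.Nonempty) (hJopen : IsOpen J) (hJconn : J.OrdConnected)
    (ρ ρ' lam₁ lam₁' lam₂ lam₂' α α' : ℝ → ℝ)
    (hρ : ∀ u ∈ I, HasDerivAt ρ (ρ' u) u)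
    (hl₁ : ∀ u ∈ I, HasDerivAt lam₁ (lam₁' u) u)
    (hl₂ : ∀ u ∈ I, HasDerivAt lam₂ (lam₂' u) u)
    (hα : ∀ v ∈ J, HasDerivAt α (α' v) v)
    (hpos : ∀ u ∈ I, 0 < ρ u)
    (humb : ∀ u ∈ I, lam₁ u ≠ lam₂ u)
    (hv₀ : ∃ v₀ ∈ J, Real.sinh (2 * α v₀) ≠ 0)
    (hcod1 : ∀ u ∈ I, ∀ v ∈ J,
      Real.sinh (2 * α v) * ρ u * (lam₁' u + lam₂' u) = 0)
    (hcod2 : ∀ u ∈ I, ∀ v ∈ J,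
      Real.sinh (α v) ^ 2 * lam₁' u + Real.cosh (α v) ^ 2 * lam₂' u
        + 1 / ρ u * (lam₁ u - lam₂ u) * (ρ u * α' v - ρ' u) = 0) :
    (∃ H : ℝ, ∀ u ∈ I, lam₁ u + lam₂ u = H) ∧
    (∃ a c : ℝ, ∀ v ∈ J, α v = a * v + c) := by
  obtain ⟨v₀, hv₀J, hv₀⟩ := hv₀
  have hsum : ∀ u ∈ I, lam₁' u + lam₂' u = 0 := fun u hu =>
    (mul_eq_zero.mp (hcod1 u hu v₀ hv₀J)).resolve_left (mul_ne_zero hv₀ (hpos u hu).ne')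
  obtain ⟨u₀, hu₀⟩ := hIne
  refine ⟨⟨lam₁ u₀ + lam₂ u₀, fun u hu => ?_⟩, α' v₀, α v₀ - α' v₀ * v₀, fun v hv => ?_⟩
  · refine const_aux I hIconn (fun u => lam₁ u + lam₂ u) (fun w hw => ?_) u hu u₀ hu₀
    have h := (hl₁ w hw).add (hl₂ w hw)
    rw [hsum w hw] at h
    exact h
  · have hα' : ∀ w ∈ J, α' w = α' v₀ := by
      intro w hw
      have h1 := hcod2 u₀ hu₀ w hw
      have h2 := hcod2 u₀ hu₀ v₀ hv₀J
      have hs : lam₁' u₀ = - lam₂' u₀ := by linarith [hsum u₀ hu₀]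
      rw [hs, Real.cosh_sq] at h1 h2
      have hρ0 := (hpos u₀ hu₀).ne'
      have hd : lam₁ u₀ - lam₂ u₀ ≠ 0 := sub_ne_zero.mpr (humb u₀ hu₀)
      have h3 : (1 / ρ u₀ * (lam₁ u₀ - lam₂ u₀) * ρ u₀) * (α' w - α' v₀) = 0 := by
        linear_combination h1 - h2
      exact sub_eq_zero.mp ((mul_eq_zero.mp h3).resolve_left
        (mul_ne_zero (mul_ne_zero (one_div_ne_zero hρ0) hd) hρ0))
    have h := const_aux J hJconn (fun v => α v - α' v₀ * v) (fun w hw => by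
      have h := (hα w hw).sub ((hasDerivAt_id w).const_mul (α' v₀))
      rw [hα' w hw, mul_one, sub_self] at h
      exact h) v hv v₀ hv₀J
    linarith
end
end

section
/- Let a, A ∈ ℝ with a ≠ 0 and A > 0. Define X : ℝ² → ℝ³ by X(u,v) = ( e^{2au}·cosh(2av)/(4a²) , (4au − A²e^{4au}·cosh(4av))/(16a²A) , −(A²e^{4au}·sinh(4av) + 4av)/(16a²A) ). Then for all (u,v) ∈ ℝ²: ⟨X_u, X_u⟩ = (A²e^{4au} + 1)²/(16a²A²), ⟨X_v, X_v⟩ = −(A²e^{4au} + 1)²/(16a²A²), ⟨X_u, X_v⟩ = 0, and X_{uu} − X_{vv} = 0. In particular, X is a timelike zero mean curvature surface with first fundamental form (A²e^{4au}+1)²/(16a²A²)·(du² − dv²). -/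
noncomputable section

open Real

/-- The timelike intrinsic rotational ZMC surface with twist `α(v) = av`,
signature pattern `δ = −ε = 1`, resonant case `B = 2a`. -/
def XT2 (a A : ℝ) (u v : ℝ) : ℝ × ℝ × ℝ :=
  (Real.exp (2 * a * u) * Real.cosh (2 * a * v) / (4 * a ^ 2),
   (4 * a * u - A ^ 2 * Real.exp (4 * a * u) * Real.cosh (4 * a * v)) /
      (16 * a ^ 2 * A),
   -((A ^ 2 * Real.exp (4 * a * u) * Real.sinh (4 * a * v) + 4 * a * v) /
      (16 * a ^ 2 * A)))

theorem hexp (k u : ℝ) : HasDerivAt (fun t => Real.exp (k * t)) (k * Real.exp (k * u)) u := by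
  have h := ((hasDerivAt_id u).const_mul k).exp
  simpa [mul_comm] using h

theorem hcosh (k u : ℝ) : HasDerivAt (fun t => Real.cosh (k * t)) (k * Real.sinh (k * u)) u := by
  have h := ((hasDerivAt_id u).const_mul k).cosh
  simpa [mul_comm] using h

theorem hsinh (k u : ℝ) : HasDerivAt (fun t => Real.sinh (k * t)) (k * Real.cosh (k * u)) u := by
  have h := ((hasDerivAt_id u).const_mul k).sinh
  simpa [mul_comm] using h

theorem hlin (k u : ℝ) : HasDerivAt (fun t => k * t) k u := by
  simpa using (hasDerivAt_id u).const_mul k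

theorem pu_XT2 (a A : ℝ) : pu (XT2 a A) = fun u v =>
    ((2 * a * Real.exp (2 * a * u)) * Real.cosh (2 * a * v) / (4 * a ^ 2),
     (4 * a - A ^ 2 * (4 * a * Real.exp (4 * a * u)) * Real.cosh (4 * a * v)) / (16 * a ^ 2 * A),
     -((A ^ 2 * (4 * a * Real.exp (4 * a * u)) * Real.sinh (4 * a * v)) / (16 * a ^ 2 * A))) := by
  funext u v
  apply HasDerivAt.deriv
  unfold XT2
  refine HasDerivAt.prodMk ?_ (HasDerivAt.prodMk ?_ ?_)
  · exact ((hexp (2 * a) u).mul_const _).div_const _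
  · exact ((hlin (4 * a) u).sub (((hexp (4 * a) u).const_mul _).mul_const _)).div_const _
  · exact (((((hexp (4 * a) u).const_mul _).mul_const _).add_const _).div_const _).neg

theorem pv_XT2 (a A : ℝ) : pv (XT2 a A) = fun u v =>
    (Real.exp (2 * a * u) * (2 * a * Real.sinh (2 * a * v)) / (4 * a ^ 2),
     (-(A ^ 2 * Real.exp (4 * a * u) * (4 * a * Real.sinh (4 * a * v)))) / (16 * a ^ 2 * A),
     -((A ^ 2 * Real.exp (4 * a * u) * (4 * a * Real.cosh (4 * a * v)) + 4 * a)
        / (16 * a ^ 2 * A))) := by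
  funext u v
  apply HasDerivAt.deriv
  unfold XT2
  refine HasDerivAt.prodMk ?_ (HasDerivAt.prodMk ?_ ?_)
  · exact ((hcosh (2 * a) v).const_mul _).div_const _
  · exact (((hcosh (4 * a) v).const_mul _).const_sub _).div_const _
  · exact ((((hsinh (4 * a) v).const_mul _).add (hlin (4 * a) v)).div_const _).neg

theorem puu_XT2 (a A u v : ℝ) : pu (pu (XT2 a A)) u v =
    ((2 * a * (2 * a * Real.exp (2 * a * u))) * Real.cosh (2 * a * v) / (4 * a ^ 2),
     (-(A ^ 2 * (4 * a * (4 * a * Real.exp (4 * a * u))) * Real.cosh (4 * a * v)))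
        / (16 * a ^ 2 * A),
     -((A ^ 2 * (4 * a * (4 * a * Real.exp (4 * a * u))) * Real.sinh (4 * a * v))
        / (16 * a ^ 2 * A))) := by
  rw [pu_XT2]
  apply HasDerivAt.deriv
  refine HasDerivAt.prodMk ?_ (HasDerivAt.prodMk ?_ ?_)
  · exact (((hexp (2 * a) u).const_mul _).mul_const _).div_const _
  · exact (((((hexp (4 * a) u).const_mul _).const_mul _).mul_const _).const_sub _).div_const _
  · exact (((((hexp (4 * a) u).const_mul _).const_mul _).mul_const _).div_const _).neg

theorem pvv_XT2 (a A u v : ℝ) : pv (pv (XT2 a A)) u v =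
    (Real.exp (2 * a * u) * (2 * a * (2 * a * Real.cosh (2 * a * v))) / (4 * a ^ 2),
     (-(A ^ 2 * Real.exp (4 * a * u) * (4 * a * (4 * a * Real.cosh (4 * a * v)))))
        / (16 * a ^ 2 * A),
     -((A ^ 2 * Real.exp (4 * a * u) * (4 * a * (4 * a * Real.sinh (4 * a * v))))
        / (16 * a ^ 2 * A))) := by
  rw [pv_XT2]
  apply HasDerivAt.deriv
  refine HasDerivAt.prodMk ?_ (HasDerivAt.prodMk ?_ ?_)
  · exact (((hsinh (2 * a) v).const_mul _).const_mul _).div_const _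
  · exact ((((hsinh (4 * a) v).const_mul _).const_mul _).neg).div_const _
  · exact (((((hcosh (4 * a) v).const_mul _).const_mul _).add_const _).div_const _).neg

/-- The surface `XT2 a A` is a paraconformal wave-harmonic parametrization, hence a
timelike zero mean curvature surface with first fundamental form
`(A²e^{4au}+1)²/(16a²A²)·(du² − dv²)`. -/
theorem stmt14 (a A : ℝ) (ha : a ≠ 0) (hA : 0 < A) (u v : ℝ) :
    lint (pu (XT2 a A) u v) (pu (XT2 a A) u v)
        = (A ^ 2 * Real.exp (4 * a * u) + 1) ^ 2 / (16 * a ^ 2 * A ^ 2) ∧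
    lint (pv (XT2 a A) u v) (pv (XT2 a A) u v)
        = -((A ^ 2 * Real.exp (4 * a * u) + 1) ^ 2 / (16 * a ^ 2 * A ^ 2)) ∧
    lint (pu (XT2 a A) u v) (pv (XT2 a A) u v) = 0 ∧
    pu (pu (XT2 a A)) u v - pv (pv (XT2 a A)) u v = 0 := by
  have hA' : A ≠ 0 := hA.ne'
  have hE : Real.exp (4 * a * u) = Real.exp (2 * a * u) ^ 2 := by
    rw [← Real.exp_nat_mul]; congr 1; push_cast; ring
  have h4 : 4 * a * v = 2 * (2 * a * v) := by ring
  have hC : Real.cosh (4 * a * v) = Real.cosh (2 * a * v) ^ 2 + Real.sinh (2 * a * v) ^ 2 := by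
    rw [h4, Real.cosh_two_mul]
  have hS : Real.sinh (4 * a * v) = 2 * Real.sinh (2 * a * v) * Real.cosh (2 * a * v) := by
    rw [h4, Real.sinh_two_mul]
  have hcs : Real.cosh (2 * a * v) ^ 2 = Real.sinh (2 * a * v) ^ 2 + 1 := Real.cosh_sq _
  rw [puu_XT2, pvv_XT2, pu_XT2, pv_XT2]
  simp only [lint, hE, hC, hS]
  generalize Real.exp (2 * a * u) = e
  generalize Real.cosh (2 * a * v) = c at *
  generalize Real.sinh (2 * a * v) = s at *
  refine ⟨?_, ?_, ?_, ?_⟩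
  · field_simp
    grind
  · field_simp
    grind
  · field_simp
    ring
  · ext <;> simp <;> ring
end
end
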